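/- Let X ⊂ P³(K) be a smooth surface of degree d ≥ 3 over an algebraically closed field K of characteristic 0 or of characteristic p > d. Then the set of points P ∈ X such that there are infinitely many lines L with P ∈ L and i(P, L.X) ≥ 3 is finite. -/

import Mathlib

open MvPolynomial

/-- The restriction of the polynomial `g` to the line through `[u]` spanned by `u` and `v`,
under the linear parametrization `t ↦ u + t • v`. -/
noncomputable def restrictLine {K : Type*} [CommSemiring K] {n : ℕ}
    (g : MvPolynomial (Fin n) K) (u v : Fin n → K) : Polynomial K :=
  MvPolynomial.aeval (fun i => Polynomial.C (u i) + Polynomial.X * Polynomial.C (v i)) g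

/-- `ordGE g u v k` means: the order of vanishing at the point `P = [u]` of the restriction
of `g` to the line spanned by `u` and `v` is at least `k` (this includes the case of the
identically vanishing restriction, i.e. order `∞`). -/
def ordGE {K : Type*} [CommSemiring K] {n : ℕ}
    (g : MvPolynomial (Fin n) K) (u v : Fin n → K) (k : ℕ) : Prop :=
  ∀ j < k, (restrictLine g u v).coeff j = 0

/-- `f` defines a smooth surface of degree `d` in `ℙ³(K)`: `f` is homogeneous of degree `d`
and its four partial derivatives have no common zero in `ℙ³(K)`. -/
def IsSmoothSurfaceOfDegree {K : Type*} [CommSemiring K]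
    (f : MvPolynomial (Fin 4) K) (d : ℕ) : Prop :=
  f.IsHomogeneous d ∧
    ∀ w : Fin 4 → K, w ≠ 0 → ∃ i : Fin 4, MvPolynomial.eval w (MvPolynomial.pderiv i f) ≠ 0

/-- A line in `ℙ³(K)` (the projectivization of a 2-dimensional linear subspace `W` of `K⁴`)
that is contained in the surface `{f = 0}`. -/
def IsLineInSurface {K : Type*} [Field K]
    (f : MvPolynomial (Fin 4) K) (W : Submodule K (Fin 4 → K)) : Prop :=
  Module.finrank K W = 2 ∧ ∀ v ∈ W, MvPolynomial.eval v f = 0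

theorem span_pair_eq_of_finrank_eq_two {K V : Type*} [Field K] [AddCommGroup V] [Module K V]
    {W : Submodule K V} (hW : Module.finrank K W = 2) {u v : V} (hu : u ∈ W) (hv : v ∈ W)
    (h : LinearIndependent K ![u, v]) : Submodule.span K (Set.range ![u, v]) = W := by
  have : FiniteDimensional K W := Module.finite_of_finrank_eq_succ hW
  refine Submodule.eq_of_le_of_finrank_eq ?_ ?_
  · rw [Submodule.span_le]
    rintro _ ⟨i, rfl⟩
    fin_cases i <;> simpa
  · rw [finrank_span_eq_card h, hW]; simp

theorem exists_linearIndependent_pair_of_finrank_eq_two {K V : Type*} [Field K] [AddCommGroup V]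
    [Module K V] {W : Submodule K V} (hW : Module.finrank K W = 2) {u : V} (hu : u ≠ 0) :
    ∃ v ∈ W, LinearIndependent K ![u, v] := by
  by_contra! h
  have hle : W ≤ Submodule.span K {u} := by
    intro v hv
    have := h v hv
    rw [LinearIndependent.pair_iff' hu] at this
    push Not at this
    obtain ⟨a, rfl⟩ := this
    exact Submodule.smul_mem _ _ (Submodule.mem_span_singleton_self u)
  have := Submodule.finrank_mono hle
  rw [hW, finrank_span_singleton hu] at this
  omega

/-- A symmetric bilinear form having `u` in its radical on a hyperplane `ker g` of a
four-dimensional space, and three isotropic planes through `u` in that hyperplane, vanishes on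
the hyperplane. -/
theorem bilin_eq_zero_of_three_isotropic_planes {K V : Type*} [Field K] [AddCommGroup V]
    [Module K V] (hV : Module.finrank K V = 4) (h2 : (2 : K) ≠ 0) {g : V →ₗ[K] K} (hg : g ≠ 0)
    {B : V →ₗ[K] V →ₗ[K] K} (hB : ∀ x y, B x y = B y x) {u : V} (hu : u ≠ 0) (hgu : g u = 0)
    (hBu : ∀ y, g y = 0 → B u y = 0) {S : Set (Submodule K V)} (hS : S.Infinite)
    (hW : ∀ W ∈ S, Module.finrank K W = 2 ∧ u ∈ W ∧
      ∀ v ∈ W, LinearIndependent K ![u, v] → g v = 0 ∧ B v v = 0)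
    {x y : V} (hx : g x = 0) (hy : g y = 0) : B x y = 0 := by
  have : FiniteDimensional K V := Module.finite_of_finrank_eq_succ hV
  obtain ⟨T, hTS, hT⟩ := hS.exists_subset_card_eq 3
  obtain ⟨W₁, W₂, W₃, h₁₂, h₁₃, h₂₃, rfl⟩ := Finset.card_eq_three.mp hT
  obtain ⟨d₁, m₁, p₁⟩ := hW W₁ (hTS (by simp))
  obtain ⟨d₂, m₂, p₂⟩ := hW W₂ (hTS (by simp))
  obtain ⟨d₃, m₃, p₃⟩ := hW W₃ (hTS (by simp))
  obtain ⟨v₁, i₁, l₁⟩ := exists_linearIndependent_pair_of_finrank_eq_two d₁ hu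
  obtain ⟨v₂, i₂, l₂⟩ := exists_linearIndependent_pair_of_finrank_eq_two d₂ hu
  obtain ⟨v₃, i₃, l₃⟩ := exists_linearIndependent_pair_of_finrank_eq_two d₃ hu
  obtain ⟨g₁, q₁⟩ := p₁ v₁ i₁ l₁
  obtain ⟨g₂, q₂⟩ := p₂ v₂ i₂ l₂
  obtain ⟨g₃, q₃⟩ := p₃ v₃ i₃ l₃
  have key : ∀ {W W' : Submodule K V} {v : V}, Module.finrank K W = 2 →
      Module.finrank K W' = 2 → u ∈ W → v ∈ W → u ∈ W' → LinearIndependent K ![u, v] → W ≠ W' →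
      v ∉ W' := by
    intro W W' v dW dW' uW vW uW' l hne hv
    exact hne ((span_pair_eq_of_finrank_eq_two dW uW vW l).symm.trans
      (span_pair_eq_of_finrank_eq_two dW' uW' hv l))
  have li : LinearIndependent K ![v₂, u, v₁] := by
    refine linearIndependent_finCons.mpr ⟨l₁, ?_⟩
    rw [span_pair_eq_of_finrank_eq_two d₁ m₁ i₁ l₁]
    exact key d₂ d₁ m₂ i₂ m₁ l₂ h₁₂.symm
  have hker : Module.finrank K (LinearMap.ker g) = 3 := by
    have := Module.Dual.finrank_ker_add_one_of_ne_zero hg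
    omega
  have hspan : Submodule.span K (Set.range ![v₂, u, v₁]) = LinearMap.ker g := by
    refine Submodule.eq_of_le_of_finrank_eq ?_ ?_
    · rw [Submodule.span_le]
      rintro _ ⟨i, rfl⟩
      fin_cases i <;> simpa
    · rw [finrank_span_eq_card li, hker]; simp
  have dec : ∀ z, g z = 0 → ∃ a b c : K, z = a • u + b • v₁ + c • v₂ := by
    intro z hz
    have : z ∈ Submodule.span K (Set.range ![v₂, u, v₁]) := by rw [hspan]; exact hz
    obtain ⟨c, hc⟩ := (Submodule.mem_span_range_iff_exists_fun K).mp this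
    refine ⟨c 1, c 2, c 0, ?_⟩
    rw [← hc]
    simp [Fin.sum_univ_three]
    abel
  have b12 : B v₁ v₂ = 0 := by
    obtain ⟨a, b, c, h⟩ := dec v₃ g₃
    have hb : b ≠ 0 := by
      rintro rfl
      refine key d₃ d₂ m₃ i₃ m₂ l₃ h₂₃.symm ?_
      rw [h]
      simpa using W₂.add_mem (W₂.smul_mem _ m₂) (W₂.smul_mem _ i₂)
    have hc : c ≠ 0 := by
      rintro rfl
      refine key d₃ d₁ m₃ i₃ m₁ l₃ h₁₃.symm ?_
      rw [h]
      simpa using W₁.add_mem (W₁.smul_mem _ m₁) (W₁.smul_mem _ i₁)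
    rw [h] at q₃
    simp only [map_add, map_smul, LinearMap.add_apply, LinearMap.smul_apply, smul_eq_mul, q₁, q₂,
      hBu _ hgu, hBu _ g₁, hBu _ g₂, hB v₁ u, hB v₂ u, hB v₂ v₁] at q₃
    have : 2 * b * c * B v₁ v₂ = 0 := by linear_combination q₃
    simpa [h2, hb, hc] using this
  obtain ⟨a, b, c, rfl⟩ := dec x hx
  obtain ⟨a', b', c', rfl⟩ := dec y hy
  simp [q₁, q₂, hBu _ hgu, hBu _ g₁, hBu _ g₂, hB v₁ u, hB v₂ u, hB v₂ v₁, b12]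

/-- A symmetric bilinear form vanishing on the hyperplane `ker g` is the symmetric product of `g`
with another linear form. -/
theorem exists_eq_symmetric_product {K V : Type*} [Field K] [AddCommGroup V] [Module K V]
    (h2 : (2 : K) ≠ 0) {g : V →ₗ[K] K} (hg : g ≠ 0) {B : V →ₗ[K] V →ₗ[K] K}
    (hB : ∀ x y, B x y = B y x) (h : ∀ x y, g x = 0 → g y = 0 → B x y = 0) :
    ∃ l : V →ₗ[K] K, ∀ x y, B x y = l x * g y + l y * g x := by
  obtain ⟨e₀, he₀⟩ : ∃ e, g e ≠ 0 := by
    by_contra! h0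
    exact hg (LinearMap.ext h0)
  obtain ⟨e, he⟩ : ∃ e, g e = 1 := ⟨(g e₀)⁻¹ • e₀, by simp [he₀]⟩
  refine ⟨B e - (B e e / 2) • g, fun x y ↦ ?_⟩
  have h0 := h (x - g x • e) (y - g y • e) (by simp [he]) (by simp [he])
  simp only [map_sub, map_smul, LinearMap.sub_apply, LinearMap.smul_apply, smul_eq_mul,
    hB x e] at h0 ⊢
  have : B e e / 2 * 2 = B e e := div_mul_cancel₀ _ h2
  linear_combination h0 + g x * g y * this

theorem derivative_restrictLine {K : Type*} [CommRing K] {n : ℕ} (g : MvPolynomial (Fin n) K)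
    (u v : Fin n → K) : (restrictLine g u v).derivative =
      ∑ i, Polynomial.C (v i) * restrictLine (pderiv i g) u v := by
  induction g using MvPolynomial.induction_on with
  | C a => simp [restrictLine, Polynomial.algebraMap_eq]
  | add p q hp hq =>
    simp only [restrictLine, map_add, mul_add, Finset.sum_add_distrib] at *
    rw [hp, hq]
  | mul_X p k hp =>
    simp only [restrictLine, map_mul, pderiv_mul, map_add, Polynomial.derivative_mul, aeval_X] at *
    rw [hp]
    simp only [mul_add, Finset.sum_add_distrib, Finset.sum_mul, pderiv_X, mul_assoc]
    congr 1
    simp [Pi.single_apply]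
    exact mul_comm _ _

theorem coeff_zero_restrictLine {K : Type*} [CommRing K] {n : ℕ} (g : MvPolynomial (Fin n) K)
    (u v : Fin n → K) : (restrictLine g u v).coeff 0 = eval u g := by
  induction g using MvPolynomial.induction_on with
  | C a => simp [restrictLine, Polynomial.algebraMap_eq]
  | add p q hp hq => simp_all [restrictLine]
  | mul_X p k hp => simp_all [restrictLine, Polynomial.mul_coeff_zero]

theorem coeff_one_restrictLine {K : Type*} [CommRing K] {n : ℕ} (g : MvPolynomial (Fin n) K)
    (u v : Fin n → K) : (restrictLine g u v).coeff 1 = ∑ i, v i * eval u (pderiv i g) := by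
  have := Polynomial.coeff_derivative (restrictLine g u v) 0
  rw [derivative_restrictLine, Polynomial.finsetSum_coeff] at this
  simpa [Polynomial.coeff_C_mul, coeff_zero_restrictLine] using this.symm

theorem two_mul_coeff_two_restrictLine {K : Type*} [CommRing K] {n : ℕ}
    (g : MvPolynomial (Fin n) K) (u v : Fin n → K) : 2 * (restrictLine g u v).coeff 2 =
      ∑ i, ∑ j, v i * (v j * eval u (pderiv j (pderiv i g))) := by
  have := Polynomial.coeff_derivative (restrictLine g u v) 1
  rw [derivative_restrictLine, Polynomial.finsetSum_coeff] at this
  simp only [Polynomial.coeff_C_mul, coeff_one_restrictLine, Finset.mul_sum] at this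
  rw [this]
  push_cast
  ring

theorem pderiv_pderiv_comm {R σ : Type*} [CommSemiring R] (i j : σ) (p : MvPolynomial σ R) :
    pderiv i (pderiv j p) = pderiv j (pderiv i p) := by
  ext m
  classical
  simp only [coeff_pderiv, Finsupp.add_apply, Finsupp.single_apply, add_right_comm m]
  by_cases h : i = j
  · subst h; rfl
  · simp [h, Ne.symm h]; ring

theorem euler_hessian {K : Type*} [CommRing K] {n d : ℕ} {f : MvPolynomial (Fin n) K}
    (hf : f.IsHomogeneous d) (u : Fin n → K) (j : Fin n) :
    ∑ i, u i * eval u (pderiv i (pderiv j f)) = (d - 1 : ℕ) * eval u (pderiv j f) := by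
  simpa [eval_sum] using congrArg (eval u) (hf.pderiv (i := j)).sum_X_mul_pderiv

theorem euler_gradient {K : Type*} [CommRing K] {n d : ℕ} {f : MvPolynomial (Fin n) K}
    (hf : f.IsHomogeneous d) (u : Fin n → K) :
    ∑ i, u i * eval u (pderiv i f) = d * eval u f := by
  simpa [eval_sum] using congrArg (eval u) hf.sum_X_mul_pderiv

/-- At a point of a smooth surface with infinitely many asymptotic lines, the Hessian of the
equation is the symmetric product of the gradient with a nonzero vector. -/
theorem exists_hessian_eq_symmetric_product {K : Type*} [Field K] {d : ℕ} (h2 : (2 : K) ≠ 0)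
    (hd : ((d - 1 : ℕ) : K) ≠ 0) {f : MvPolynomial (Fin 4) K} (hf : IsSmoothSurfaceOfDegree f d)
    {u : Fin 4 → K} (hu : u ≠ 0) (hfu : eval u f = 0)
    (hS : {W : Submodule K (Fin 4 → K) | Module.finrank K W = 2 ∧ u ∈ W ∧
      ∀ v ∈ W, LinearIndependent K ![u, v] → ordGE f u v 3}.Infinite) :
    ∃ l : Fin 4 → K, l ≠ 0 ∧ ∀ i j, eval u (pderiv i (pderiv j f)) =
      l i * eval u (pderiv j f) + l j * eval u (pderiv i f) := by
  obtain ⟨i₀, hi₀⟩ := hf.2 u hu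
  let G : (Fin 4 → K) →ₗ[K] K := Fintype.linearCombination K fun i ↦ eval u (pderiv i f)
  have hG : ∀ v, G v = ∑ i, v i * eval u (pderiv i f) := fun v ↦ by
    simp [G, Fintype.linearCombination_apply]
  let M : Matrix (Fin 4) (Fin 4) K := .of fun i j ↦ eval u (pderiv i (pderiv j f))
  let B : (Fin 4 → K) →ₗ[K] (Fin 4 → K) →ₗ[K] K := Matrix.toLinearMap₂' K M
  have hM : ∀ x y, B x y = ∑ i, ∑ j, x i * (y j * eval u (pderiv i (pderiv j f))) := fun x y ↦ by
    simp [B, M, Matrix.toLinearMap₂'_apply]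
  have hsymm : ∀ x y, B x y = B y x := fun x y ↦ by
    rw [hM, hM, Finset.sum_comm]
    refine Finset.sum_congr rfl fun i _ ↦ Finset.sum_congr rfl fun j _ ↦ ?_
    rw [pderiv_pderiv_comm]
    ring
  have hG1 : ∀ i, G (Pi.single i 1) = eval u (pderiv i f) := fun i ↦ by
    simp [hG, Pi.single_apply]
  have hG0 : G ≠ 0 := fun h ↦ hi₀ (by rw [← hG1, h]; rfl)
  have hGu : G u = 0 := by rw [hG, euler_gradient hf.1, hfu, mul_zero]
  have hBu : ∀ y, B u y = (d - 1 : ℕ) * G y := fun y ↦ by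
    rw [hM, hG, Finset.sum_comm, Finset.mul_sum]
    refine Finset.sum_congr rfl fun j _ ↦ ?_
    rw [mul_left_comm, ← euler_hessian hf.1, Finset.mul_sum]
    exact Finset.sum_congr rfl fun i _ ↦ by ring
  have hzero : ∀ x y, G x = 0 → G y = 0 → B x y = 0 := fun x y hx hy ↦ by
    refine bilin_eq_zero_of_three_isotropic_planes (by simp) h2 hG0 hsymm hu hGu
      (fun y hy ↦ by rw [hBu, hy, mul_zero]) hS (fun W hW ↦ ⟨hW.1, hW.2.1, fun v hv l ↦ ?_⟩) hx hy
    have ho := hW.2.2 v hv l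
    refine ⟨by rw [hG, ← coeff_one_restrictLine, ho 1 (by norm_num)], ?_⟩
    have := two_mul_coeff_two_restrictLine f u v
    rw [ho 2 (by norm_num), mul_zero] at this
    rw [hM, this]
    refine Finset.sum_congr rfl fun i _ ↦ Finset.sum_congr rfl fun j _ ↦ ?_
    rw [pderiv_pderiv_comm]
  obtain ⟨l, hl⟩ := exists_eq_symmetric_product h2 hG0 hsymm hzero
  have hM1 : ∀ i j, B (Pi.single i 1) (Pi.single j 1) = eval u (pderiv i (pderiv j f)) :=
    fun i j ↦ by simp [hM, Pi.single_apply]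
  refine ⟨fun i ↦ l (Pi.single i 1), fun h0 ↦ hi₀ ?_, fun i j ↦ by
    rw [← hM1, hl, hG1, hG1]⟩
  have hl0 : l = 0 := LinearMap.pi_ext' fun i ↦ LinearMap.ext_ring (congrFun h0 i)
  have := hl u (Pi.single i₀ 1)
  rw [hBu, hG1, hl0] at this
  simpa [hd] using this

theorem homogeneousComponent_mul_of_isHomogeneous {R σ : Type*} [CommSemiring R]
    {p q : MvPolynomial σ R} {e n : ℕ} (hq : q.IsHomogeneous e) (h : e ≤ n) :
    homogeneousComponent n (p * q) = homogeneousComponent (n - e) p * q := by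
  let _ : GradedAlgebra (homogeneousSubmodule σ R) := MvPolynomial.gradedAlgebra
  have := DirectSum.coe_decompose_mul_of_right_mem_of_le (𝒜 := homogeneousSubmodule σ R) (a := p)
    (b := q) hq h
  rw [← decomposition.decompose'_apply, ← decomposition.decompose'_apply]
  exact this

/-- If homogeneous polynomials of the same degree have no common projective zero, every
homogeneous polynomial of large degree is a combination of them with homogeneous coefficients. -/
theorem exists_homogeneous_combination {K σ ι : Type*} [Field K] [IsAlgClosed K] [Finite σ]
    [Fintype ι] {e : ℕ} {h : ι → MvPolynomial σ K} (hh : ∀ i, (h i).IsHomogeneous e)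
    (h0 : ∀ w, w ≠ 0 → ∃ i, eval w (h i) ≠ 0) :
    ∃ n₀, ∀ n, n₀ ≤ n → ∀ G : MvPolynomial σ K, G.IsHomogeneous n → e ≤ n ∧
      ∃ b : ι → MvPolynomial σ K, (∀ i, (b i).IsHomogeneous (n - e)) ∧ G = ∑ i, b i * h i := by
  have hle : idealOfVars σ K ≤ (Ideal.span (Set.range h)).radical := by
    rw [← vanishingIdeal_zeroLocus_eq_radical (K := K), idealOfVars, Ideal.span_le]
    rintro _ ⟨i, rfl⟩
    rw [SetLike.mem_coe, mem_vanishingIdeal_iff]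
    intro w hw
    rw [zeroLocus_span] at hw
    have : w = 0 := by
      by_contra hne
      obtain ⟨j, hj⟩ := h0 w hne
      exact hj (by simpa [aeval_eq_eval] using hw (h j) ⟨j, rfl⟩)
    simp [this]
  obtain ⟨N, hN⟩ := Ideal.exists_pow_le_of_le_radical_of_fg hle (idealOfVars_fg σ K)
  refine ⟨max N e, fun n hn G hG ↦ ⟨le_of_max_le_right hn, ?_⟩⟩
  have hmem : G ∈ Ideal.span (Set.range h) := by
    refine hN ((mem_pow_idealOfVars_iff' N G).mpr fun x hx ↦ ?_)
    refine hG.coeff_eq_zero (fun hx' ↦ ?_)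
    have := le_of_max_le_left hn
    omega
  obtain ⟨c, hc⟩ := Ideal.mem_span_range_iff_exists_fun.mp hmem
  refine ⟨fun i ↦ homogeneousComponent (n - e) (c i),
    fun i ↦ homogeneousComponent_isHomogeneous _ _, ?_⟩
  rw [← homogeneousComponent_eq_self hG, ← hc, map_sum]
  exact Finset.sum_congr rfl fun i _ ↦
    homogeneousComponent_mul_of_isHomogeneous (hh i) (le_of_max_le_right hn)

/-- Evaluation at the points `z k`. -/
noncomputable def evalPoints {K σ ι : Type*} [CommSemiring K] (z : ι → σ → K) :
    MvPolynomial σ K →ₗ[K] ι → K :=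
  LinearMap.pi fun k ↦ (aeval (z k)).toLinearMap

theorem evalPoints_apply {K σ ι : Type*} [CommSemiring K] (z : ι → σ → K) (p : MvPolynomial σ K)
    (k : ι) : evalPoints z p k = eval (z k) p := by
  simp [evalPoints, aeval_eq_eval]

theorem exists_linear_form_eval {K σ : Type*} [Field K] [Fintype σ] {x y : σ → K}
    (h : x ∉ Submodule.span K {y}) :
    ∃ p : MvPolynomial σ K, p.IsHomogeneous 1 ∧ eval x p ≠ 0 ∧ eval y p = 0 := by
  classical
  obtain ⟨φ, hx, hy⟩ := Submodule.exists_le_ker_of_notMem h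
  have key : ∀ w, eval w (∑ i, C (φ (Pi.single i 1)) * X i) = φ w := fun w ↦ by
    conv_rhs => rw [pi_eq_sum_univ' w, map_sum]
    simp [mul_comm]
  refine ⟨∑ i, C (φ (Pi.single i 1)) * X i, IsHomogeneous.sum _ _ _ fun i _ ↦ ?_, ?_, ?_⟩
  · simpa using (isHomogeneous_C σ _).mul (isHomogeneous_X K i)
  · rwa [key]
  · rw [key]
    exact hy (Submodule.mem_span_singleton_self y)

theorem map_evalPoints_eq_top {K σ ι : Type*} [Field K] [Fintype σ] [Fintype ι] {z : ι → σ → K}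
    (hz : ∀ i j, i ≠ j → z i ∉ Submodule.span K {z j}) :
    (homogeneousSubmodule σ K (Fintype.card ι - 1)).map (evalPoints z) = ⊤ := by
  classical
  choose! p hp hi hj using fun i j h ↦ exists_linear_form_eval (hz i j h)
  rw [eq_top_iff]
  intro c _
  rw [pi_eq_sum_univ' c]
  refine Submodule.sum_mem _ fun i _ ↦ Submodule.smul_mem _ _ ?_
  let P := ∏ j ∈ Finset.univ.erase i, p i j
  have hP : P.IsHomogeneous (Fintype.card ι - 1) := by
    have := IsHomogeneous.prod (Finset.univ.erase i) (p i) (fun _ ↦ 1)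
      fun j hj ↦ hp i j (Finset.ne_of_mem_erase hj).symm
    simpa using this
  have h1 : eval (z i) P ≠ 0 := by
    rw [eval_prod]
    exact Finset.prod_ne_zero_iff.mpr fun j hj ↦ hi i j (Finset.ne_of_mem_erase hj).symm
  refine ⟨(eval (z i) P)⁻¹ • P, Submodule.smul_mem _ _ hP, ?_⟩
  ext k
  rw [map_smul, Pi.smul_apply, evalPoints_apply]
  by_cases hk : k = i
  · subst hk
    simp [h1]
  · have : eval (z k) P = 0 := by
      rw [eval_prod]
      exact Finset.prod_eq_zero (Finset.mem_erase.mpr ⟨hk, Finset.mem_univ _⟩)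
        (hj i k (Ne.symm hk))
    simp [this, hk]

/-- If multiplication by a nowhere zero function lowers the degree of homogeneous polynomial
functions on a finite set of points, then there are few points. -/
theorem card_le_finrank_homogeneousSubmodule {K σ ι : Type*} [Field K] [Fintype σ] [Fintype ι]
    {z : ι → σ → K} (hz : ∀ i j, i ≠ j → z i ∉ Submodule.span K {z j}) {a : ι → K}
    (ha : ∀ k, a k ≠ 0) {n₀ : ℕ} (hn₀ : n₀ < Fintype.card ι)
    (h : ∀ n, n₀ ≤ n → ∀ G : MvPolynomial σ K, G.IsHomogeneous (n + 1) →
      ∃ G' : MvPolynomial σ K, G'.IsHomogeneous n ∧ ∀ k, a k * eval (z k) G = eval (z k) G') :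
    Fintype.card ι ≤ Module.finrank K (homogeneousSubmodule σ K n₀) := by
  have hfin : Module.Finite K (homogeneousSubmodule σ K n₀) :=
    Module.Finite.iff_fg.mpr (homogeneousSubmodule_fg (R := K) (σ := σ) n₀)
  let W n := (homogeneousSubmodule σ K n).map (evalPoints z)
  have hstep : ∀ n, n₀ ≤ n → Module.finrank K (W (n + 1)) ≤ Module.finrank K (W n) := by
    intro n hn
    have hinj : Function.Injective (LinearMap.mulLeft K a) := fun x y hxy ↦
      funext fun k ↦ mul_left_cancel₀ (ha k) (congrFun hxy k)
    rw [(Submodule.equivMapOfInjective _ hinj (W (n + 1))).finrank_eq]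
    refine Submodule.finrank_mono ?_
    rintro _ ⟨_, ⟨G, hG, rfl⟩, rfl⟩
    obtain ⟨G', hG', hGG'⟩ := h n hn G hG
    refine ⟨G', hG', funext fun k ↦ ?_⟩
    simp [evalPoints_apply, ← hGG']
  have hle : ∀ n, n₀ ≤ n → Module.finrank K (W n) ≤ Module.finrank K (W n₀) := by
    intro n hn
    induction n, hn using Nat.le_induction with
    | base => exact le_rfl
    | succ n hn ih => exact (hstep n hn).trans ih
  have h1 := hle (Fintype.card ι - 1) (by omega)
  rw [show W (Fintype.card ι - 1) = ⊤ from map_evalPoints_eq_top hz, finrank_top,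
    Module.finrank_fintype_fun_eq_card] at h1
  exact h1.trans (Submodule.finrank_map_le _ _)

theorem cast_ne_zero_of_le_of_lt_ringChar {K : Type*} [Field K] {d : ℕ}
    (hchar : ringChar K = 0 ∨ d < ringChar K) {n : ℕ} (h0 : n ≠ 0) (hn : n ≤ d) :
    (n : K) ≠ 0 := by
  intro h
  have hdvd := (ringChar.spec K n).mp h
  rcases hchar with h' | h'
  · exact h0 (Nat.eq_zero_of_zero_dvd (h' ▸ hdvd))
  · have := Nat.le_of_dvd (Nat.pos_of_ne_zero h0) hdvd
    omega

/-- The linear form given by the cofactor of the gradient in the Hessian lowers the degree of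
homogeneous polynomials of large degree. -/
theorem exists_lower_degree_of_hessian_eq {K : Type*} [Field K] [IsAlgClosed K] {d : ℕ}
    (hd : 2 ≤ d) (h2 : (2 : K) ≠ 0) {f : MvPolynomial (Fin 4) K}
    (hf : IsSmoothSurfaceOfDegree f d) :
    ∃ n₀, ∀ n, n₀ ≤ n → ∀ (v : Fin 4 → K) (G : MvPolynomial (Fin 4) K),
      G.IsHomogeneous (n + 1) → ∃ G' : MvPolynomial (Fin 4) K, G'.IsHomogeneous n ∧
        ∀ u l : Fin 4 → K, (∀ i j, eval u (pderiv i (pderiv j f)) =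
          l i * eval u (pderiv j f) + l j * eval u (pderiv i f)) →
        (∑ j, v j * l j) * eval u G = eval u G' := by
  have hg : ∀ i, (pderiv i f).IsHomogeneous (d - 1) := fun i ↦ hf.1.pderiv
  have hH : ∀ i j, (pderiv i (pderiv j f)).IsHomogeneous (d - 2) := fun i j ↦ (hg j).pderiv
  obtain ⟨n₀, hn₀⟩ := exists_homogeneous_combination
    (h := fun i ↦ pderiv i f * pderiv i f) (fun i ↦ (hg i).mul (hg i))
    (fun w hw ↦ by simpa using hf.2 w hw)
  refine ⟨n₀, fun n hn v G hG ↦ ?_⟩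
  obtain ⟨hle, b, hb, rfl⟩ := hn₀ (n + 1) (by omega) G hG
  have hCmul : ∀ {k : ℕ} (c : K) {p : MvPolynomial (Fin 4) K}, p.IsHomogeneous k →
      (C c * p).IsHomogeneous k := fun c _ hp ↦ by
    simpa using (isHomogeneous_C (Fin 4) c).mul hp
  let P : Fin 4 → MvPolynomial (Fin 4) K := fun i ↦
    pderiv i f * ∑ j, C (v j) * pderiv i (pderiv j f) -
      C 2⁻¹ * ((∑ j, C (v j) * pderiv j f) * pderiv i (pderiv i f))
  have hP : ∀ i, (P i).IsHomogeneous (d - 1 + (d - 2)) := fun i ↦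
    ((hg i).mul (IsHomogeneous.sum _ _ _ fun j _ ↦ hCmul _ (hH i j))).sub
      (hCmul _ ((IsHomogeneous.sum _ _ _ fun j _ ↦ hCmul _ (hg j)).mul (hH i i)))
  refine ⟨∑ i, b i * P i, IsHomogeneous.sum _ _ _ fun i _ ↦ ?_, fun u l hl ↦ ?_⟩
  · have := (hb i).mul (hP i)
    rwa [show n + 1 - (d - 1 + (d - 1)) + (d - 1 + (d - 2)) = n by omega] at this
  · rw [eval_sum, eval_sum, Finset.mul_sum]
    refine Finset.sum_congr rfl fun i _ ↦ ?_
    have h22 : (2 : K)⁻¹ * 2 = 1 := inv_mul_cancel₀ h2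
    have key : eval u (P i) = (∑ j, v j * l j) * (eval u (pderiv i f) * eval u (pderiv i f)) := by
      simp only [P, map_sub, map_mul, map_add, eval_C, hl, Fin.sum_univ_four]
      linear_combination (-(v 0 * eval u (pderiv 0 f) + v 1 * eval u (pderiv 1 f) +
        v 2 * eval u (pderiv 2 f) + v 3 * eval u (pderiv 3 f)) * l i * eval u (pderiv i f)) * h22
    rw [map_mul, map_mul, map_mul, key]
    ring

theorem finitely_many_points_with_infinitely_many_asymptotic_lines
    {K : Type*} [Field K] [IsAlgClosed K] (d : ℕ) (hd : 3 ≤ d)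
    (hchar : ringChar K = 0 ∨ d < ringChar K)
    (f : MvPolynomial (Fin 4) K) (hf : IsSmoothSurfaceOfDegree f d) :
    {P : Submodule K (Fin 4 → K) | ∃ u : Fin 4 → K, u ≠ 0 ∧ P = Submodule.span K {u} ∧
      MvPolynomial.eval u f = 0 ∧
      {W : Submodule K (Fin 4 → K) | Module.finrank K W = 2 ∧ u ∈ W ∧
        ∀ v ∈ W, LinearIndependent K ![u, v] → ordGE f u v 3}.Infinite}.Finite := by
  have h2 : (2 : K) ≠ 0 := by
    exact_mod_cast cast_ne_zero_of_le_of_lt_ringChar hchar (n := 2) (by omega) (by omega)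
  have hd1 : ((d - 1 : ℕ) : K) ≠ 0 :=
    cast_ne_zero_of_le_of_lt_ringChar hchar (by omega) (by omega)
  obtain ⟨n₀, hn₀⟩ := exists_lower_degree_of_hessian_eq (by omega) h2 hf
  by_contra hinf
  obtain ⟨T, hTS, hT⟩ := Set.Infinite.exists_subset_card_eq hinf
    (n₀ + Module.finrank K (homogeneousSubmodule (Fin 4) K n₀) + 1)
  choose z hz0 hzP hzf hzW using fun P : T ↦ hTS P.2
  choose l hl0 hl using fun P : T ↦
    exists_hessian_eq_symmetric_product h2 hd1 hf (hz0 P) (hzf P) (hzW P)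
  have hz : ∀ i j, i ≠ j → z i ∉ Submodule.span K {z j} := by
    intro i j hij hmem
    refine hij (Subtype.ext ?_)
    rw [hzP i, hzP j]
    refine Submodule.eq_of_le_of_finrank_eq ?_ ?_
    · rwa [Submodule.span_singleton_le_iff_mem]
    · rw [finrank_span_singleton (hz0 i), finrank_span_singleton (hz0 j)]
  obtain ⟨v, hv⟩ := Module.Dual.exists_forall_ne_zero_of_forall_exists
    (fun P : T ↦ Fintype.linearCombination K (l P)) fun P ↦ by
      obtain ⟨i, hi⟩ := Function.ne_iff.mp (hl0 P)
      exact ⟨Pi.single i 1, by simpa [Fintype.linearCombination_apply_single] using hi⟩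
  have := card_le_finrank_homogeneousSubmodule hz hv (n₀ := n₀)
    (by rw [Fintype.card_coe, hT]; omega) fun n hn G hG ↦ by
      obtain ⟨G', hG', h⟩ := hn₀ n hn v G hG
      refine ⟨G', hG', fun P ↦ ?_⟩
      rw [← h (z P) (l P) (hl P)]
      simp [Fintype.linearCombination_apply]
  rw [Fintype.card_coe, hT] at this
  omega
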